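/- The function ν ↦ 1 − J_{ν+1}(1)/(ν·J_ν(1)) is strictly increasing on (0, ∞). Equivalently, ν ↦ J_ν′(1)/(ν·J_ν(1)) is strictly increasing on (0, ∞). -/

import Mathlib

open Complex Metric Set Filter

/-- The Bessel function of the first kind `J_ν`, defined on `ℂ` via the principal
branch of the power `(z/2)^(2n+ν)`. -/
noncomputable def besselJ (ν : ℝ) (z : ℂ) : ℂ :=
  ∑' n : ℕ, (((-1) ^ n / (n.factorial * Real.Gamma (n + ν + 1)) : ℝ) : ℂ) *
    (z / 2) ^ ((2 * n + ν : ℝ) : ℂ)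

/-- The coefficients of the power series defining `besselJ ν`. -/
noncomputable def besselCoeff (ν : ℝ) (n : ℕ) : ℝ :=
  (-1) ^ n / (n.factorial * Real.Gamma (n + ν + 1))

/-- The terms of the series defining `besselJ ν` at `1`. -/
noncomputable def besselTerm (ν : ℝ) (n : ℕ) : ℝ :=
  besselCoeff ν n * (1 / 2 : ℝ) ^ (2 * n + ν)

/-- The real value of `besselJ ν` at `1`. -/
noncomputable def besselOne (ν : ℝ) : ℝ := ∑' n, besselTerm ν n

theorem Gamma_le_Gamma_natCast_add {ν : ℝ} (hν : 0 < ν) (n : ℕ) :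
    Real.Gamma (ν + 1) ≤ Real.Gamma (n + ν + 1) := by
  induction n with
  | zero => simp
  | succ n ih =>
    have h : Real.Gamma ((n + 1 : ℕ) + ν + 1) = (n + ν + 1) * Real.Gamma (n + ν + 1) := by
      rw [← Real.Gamma_add_one (by positivity)]
      push_cast
      ring_nf
    have hpos : 0 < Real.Gamma (n + ν + 1) := Real.Gamma_pos_of_pos (by positivity)
    rw [h]
    have hn : (0 : ℝ) ≤ n := n.cast_nonneg
    nlinarith

theorem abs_besselCoeff_le {ν : ℝ} (hν : 0 < ν) (n : ℕ) :
    |besselCoeff ν n| ≤ besselCoeff ν 0 := by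
  have h0 : 0 < Real.Gamma (ν + 1) := Real.Gamma_pos_of_pos (by positivity)
  have h := Gamma_le_Gamma_natCast_add hν n
  have hf : (1 : ℝ) ≤ n.factorial := by exact_mod_cast n.factorial_pos
  simp only [besselCoeff, abs_div, abs_mul, abs_pow, abs_neg, abs_one, one_pow, Nat.abs_cast,
    pow_zero, Nat.factorial_zero, Nat.cast_one, one_mul, Nat.cast_zero, zero_add]
  rw [abs_of_pos (h0.trans_le h)]
  gcongr
  nlinarith

theorem besselTerm_zero_pos {ν : ℝ} (hν : 0 < ν) : 0 < besselTerm ν 0 := by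
  have h0 : 0 < Real.Gamma (ν + 1) := Real.Gamma_pos_of_pos (by positivity)
  simp only [besselTerm, besselCoeff, pow_zero, Nat.factorial_zero, Nat.cast_one, one_mul,
    Nat.cast_zero, zero_add]
  positivity

theorem abs_besselTerm_le {ν : ℝ} (hν : 0 < ν) (n : ℕ) :
    |besselTerm ν n| ≤ besselTerm ν 0 * (1 / 4) ^ n := by
  have h : (1 / 2 : ℝ) ^ (2 * n + ν) = (1 / 2 : ℝ) ^ ν * (1 / 4) ^ n := by
    rw [Real.rpow_add (by norm_num), mul_comm]
    congr 1
    rw [Real.rpow_mul (by norm_num), Real.rpow_natCast]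
    norm_num
  rw [besselTerm, besselTerm, abs_mul, h, abs_of_pos (by positivity : (0 : ℝ) < _ * (1 / 4) ^ n)]
  simp only [Nat.cast_zero, mul_zero, zero_add]
  rw [← mul_assoc]
  gcongr
  exact abs_besselCoeff_le hν n

theorem summable_besselTerm {ν : ℝ} (hν : 0 < ν) : Summable (besselTerm ν) :=
  Summable.of_norm_bounded
    ((summable_geometric_of_lt_one (by norm_num) (by norm_num)).mul_left _)
    (abs_besselTerm_le hν)

theorem abs_besselOne_sub_le {ν : ℝ} (hν : 0 < ν) :
    |besselOne ν - besselTerm ν 0| ≤ besselTerm ν 0 / 3 := by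
  have h1 : besselOne ν - besselTerm ν 0 = ∑' n, besselTerm ν (n + 1) := by
    rw [besselOne, (summable_besselTerm hν).tsum_eq_zero_add]
    ring
  have hg : HasSum (fun n : ℕ => besselTerm ν 0 * (1 / 4) ^ (n + 1)) (besselTerm ν 0 / 3) := by
    have h := (hasSum_geometric_of_lt_one (r := (1 / 4 : ℝ)) (by norm_num)
      (by norm_num)).mul_left (besselTerm ν 0 * (1 / 4))
    rw [show besselTerm ν 0 * (1 / 4) * (1 - 1 / 4 : ℝ)⁻¹ = besselTerm ν 0 / 3 by
      norm_num; ring] at h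
    exact h.congr_fun fun n => by ring
  rw [h1, ← Real.norm_eq_abs]
  exact tsum_of_norm_bounded hg fun n => abs_besselTerm_le hν (n + 1)

theorem besselTerm_zero_add_one {ν : ℝ} (hν : 0 < ν) :
    2 * (ν + 1) * besselTerm (ν + 1) 0 = besselTerm ν 0 := by
  have h0 : 0 < Real.Gamma (ν + 1) := Real.Gamma_pos_of_pos (by positivity)
  simp only [besselTerm, besselCoeff, pow_zero, Nat.factorial_zero, Nat.cast_one, one_mul,
    Nat.cast_zero, zero_add, mul_zero]
  rw [Real.Gamma_add_one (by positivity), Real.rpow_add_one (by norm_num)]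
  field_simp

theorem besselOne_pos {ν : ℝ} (hν : 0 < ν) : 0 < besselOne ν := by
  have h1 := abs_le.1 (abs_besselOne_sub_le hν)
  have h2 := besselTerm_zero_pos hν
  linarith

theorem besselOne_add_one_le {ν : ℝ} (hν : 0 < ν) : besselOne (ν + 1) ≤ besselOne ν := by
  have h1 := abs_le.1 (abs_besselOne_sub_le hν)
  have h2 := abs_le.1 (abs_besselOne_sub_le (ν := ν + 1) (by positivity))
  have h3 := besselTerm_zero_add_one hν
  have h4 := besselTerm_zero_pos (ν := ν + 1) (by positivity)
  nlinarith

theorem besselTerm_recurrence {ν : ℝ} (hν : 0 < ν) (n : ℕ) :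
    besselTerm ν (n + 1) + besselTerm (ν + 1 + 1) n =
      2 * (ν + 1) * besselTerm (ν + 1) (n + 1) := by
  have h0 : 0 < Real.Gamma (n + ν + 2) := Real.Gamma_pos_of_pos (by positivity)
  have e1 : Real.Gamma (n + ν + 3) = (n + ν + 2) * Real.Gamma (n + ν + 2) := by
    rw [← Real.Gamma_add_one (by positivity)]; ring_nf
  have p1 : (1 / 2 : ℝ) ^ (2 * n + ν + 3) = (1 / 2 : ℝ) ^ (2 * n + ν + 2) * (1 / 2) := by
    rw [← Real.rpow_add_one (by norm_num)]; ring_nf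
  simp only [besselTerm, besselCoeff, Nat.factorial_succ]
  push_cast
  rw [show (n : ℝ) + 1 + ν + 1 = n + ν + 2 by ring,
    show (n : ℝ) + (ν + 1 + 1) + 1 = n + ν + 3 by ring,
    show (n : ℝ) + 1 + (ν + 1) + 1 = n + ν + 3 by ring,
    show 2 * ((n : ℝ) + 1) + ν = 2 * n + ν + 2 by ring,
    show 2 * (n : ℝ) + (ν + 1 + 1) = 2 * n + ν + 2 by ring,
    show 2 * ((n : ℝ) + 1) + (ν + 1) = 2 * n + ν + 3 by ring, e1, p1]
  field_simp
  ring

/-- The three-term recurrence for `J_ν(1)`. -/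
theorem besselOne_recurrence {ν : ℝ} (hν : 0 < ν) :
    besselOne ν + besselOne (ν + 1 + 1) = 2 * (ν + 1) * besselOne (ν + 1) := by
  have s0 := summable_besselTerm hν
  have s1 := summable_besselTerm (ν := ν + 1) (by positivity)
  have s2 := summable_besselTerm (ν := ν + 1 + 1) (by positivity)
  rw [besselOne, besselOne, besselOne, s0.tsum_eq_zero_add, s1.tsum_eq_zero_add, mul_add,
    besselTerm_zero_add_one hν, add_assoc, ← ((summable_nat_add_iff 1).2 s0).tsum_add s2,
    ← tsum_mul_left]
  simp only [besselTerm_recurrence hν]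

theorem besselOne_ratio_antitone {ν μ : ℝ} (hν : 0 < ν) (h : ν < μ) :
    besselOne (μ + 1) / besselOne μ ≤ besselOne (ν + 1) / besselOne ν := by
  set r : ℝ → ℝ := fun x => besselOne (x + 1) / besselOne x with hr
  have r_pos : ∀ x, 0 < x → 0 < r x := fun x hx =>
    div_pos (besselOne_pos (by positivity)) (besselOne_pos hx)
  have r_le : ∀ x, 0 < x → r x ≤ 1 := fun x hx =>
    (div_le_one (besselOne_pos hx)).2 (besselOne_add_one_le hx)
  have r_rec : ∀ x, 0 < x → r x * (2 * (x + 1) - r (x + 1)) = 1 := by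
    intro x hx
    have h1 := besselOne_pos hx
    have h2 := besselOne_pos (ν := x + 1) (by positivity)
    have h3 := besselOne_recurrence hx
    simp only [hr]
    field_simp
    linarith
  have step : ∀ x y, 0 < x → x < y → r x < r y →
      r (x + 1) - r (y + 1) ≤ r x - r y - 2 * (y - x) := by
    intro x y hx hxy hlt
    have hy := hx.trans hxy
    have key : r x - r y = r x * r y * (2 * (y - x) + (r (x + 1) - r (y + 1))) := by
      linear_combination r y * r_rec x hx - r x * r_rec y hy
    have hc : r x * r y ≤ 1 := mul_le_one₀ (r_le x hx) (r_pos y hy).le (r_le y hy)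
    have hc0 : 0 < r x * r y := mul_pos (r_pos x hx) (r_pos y hy)
    have hneg : 2 * (y - x) + (r (x + 1) - r (y + 1)) < 0 := by
      by_contra! hge
      have := mul_nonneg hc0.le hge
      linarith
    nlinarith
  by_contra! hlt
  have iter : ∀ n : ℕ, r (ν + n) < r (μ + n) ∧
      r (ν + n) - r (μ + n) ≤ -(2 * (μ - ν) * n) := by
    intro n
    induction n with
    | zero => simpa using ⟨hlt, hlt.le⟩
    | succ n ih =>
      have hs := step (ν + n) (μ + n) (by positivity) (by linarith) ih.1
      push_cast
      rw [← add_assoc, ← add_assoc]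
      constructor <;> nlinarith [ih.1, ih.2]
  obtain ⟨n, hn⟩ := exists_nat_gt (1 / (2 * (μ - ν)))
  rw [div_lt_iff₀ (by linarith)] at hn
  have hμ := hν.trans h
  have h1 := (iter n).2
  have h2 := r_pos (ν + n) (by positivity)
  have h3 := r_le (μ + n) (by positivity)
  nlinarith

theorem besselTerm_cast (ν : ℝ) (n : ℕ) :
    (besselTerm ν n : ℂ) =
      (besselCoeff ν n : ℂ) * (1 / 2 : ℂ) ^ ((2 * n + ν : ℝ) : ℂ) := by
  rw [besselTerm, ofReal_mul, ofReal_cpow (by norm_num)]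
  norm_num

theorem besselJ_one (ν : ℝ) : besselJ ν 1 = besselOne ν := by
  rw [besselOne, ofReal_tsum]
  exact tsum_congr fun n => (besselTerm_cast ν n).symm

theorem natCast_mul_besselTerm_succ (ν : ℝ) (n : ℕ) :
    2 * ((n + 1 : ℕ) : ℝ) * besselTerm ν (n + 1) = -besselTerm (ν + 1) n := by
  have p1 : (1 / 2 : ℝ) ^ (2 * n + ν + 2) = (1 / 2 : ℝ) ^ (2 * n + ν + 1) * (1 / 2) := by
    rw [← Real.rpow_add_one (by norm_num)]; ring_nf
  simp only [besselTerm, besselCoeff, Nat.factorial_succ]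
  push_cast
  rw [show (n : ℝ) + 1 + ν + 1 = n + ν + 2 by ring,
    show (n : ℝ) + (ν + 1) + 1 = n + ν + 2 by ring,
    show 2 * ((n : ℝ) + 1) + ν = 2 * n + ν + 2 by ring,
    show 2 * (n : ℝ) + (ν + 1) = 2 * n + ν + 1 by ring, p1]
  field_simp
  ring

theorem hasSum_deriv_besselTerm {ν : ℝ} (hν : 0 < ν) :
    HasSum (fun n : ℕ => (2 * n + ν) * besselTerm ν n)
      (ν * besselOne ν - besselOne (ν + 1)) := by
  have h1 : HasSum (fun n : ℕ => 2 * (n : ℝ) * besselTerm ν n) (-besselOne (ν + 1)) := by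
    rw [← hasSum_nat_add_iff' 1]
    simpa only [besselOne, natCast_mul_besselTerm_succ, Finset.sum_range_one,
      Nat.cast_zero, mul_zero, zero_mul, sub_zero] using (summable_besselTerm (ν := ν + 1) (by positivity)).hasSum.neg
  rw [sub_eq_add_neg]
  exact (((summable_besselTerm hν).hasSum.mul_left ν).add h1).congr_fun fun n => by ring

theorem deriv_besselJ_one {ν : ℝ} (hν : 0 < ν) :
    deriv (besselJ ν) 1 = ((ν * besselOne ν - besselOne (ν + 1) : ℝ) : ℂ) := by
  have slit : ∀ w ∈ ball (1 : ℂ) (1 / 2), w / 2 ∈ slitPlane := by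
    intro w hw
    left
    have h := (abs_re_le_norm (w - 1)).trans_lt (mem_ball_iff_norm.1 hw)
    have h' := (abs_lt.1 h).1
    simp only [sub_re, one_re] at h'
    have : (w / 2).re = w.re / 2 := by simp
    linarith
  have hd : ∀ (n : ℕ), ∀ w ∈ ball (1 : ℂ) (1 / 2), HasDerivAt
      (fun z : ℂ => (besselCoeff ν n : ℂ) * (z / 2) ^ ((2 * n + ν : ℝ) : ℂ))
      ((besselCoeff ν n : ℂ) * (((2 * n + ν : ℝ) : ℂ) *
        (w / 2) ^ (((2 * n + ν : ℝ) : ℂ) - 1) * (1 / 2))) w := fun n w hw =>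
    (((hasDerivAt_id w).div_const 2).cpow_const (slit w hw)).const_mul _
  have hs := hasSum_deriv_of_summable_norm
    (F := fun (n : ℕ) (z : ℂ) => (besselCoeff ν n : ℂ) * (z / 2) ^ ((2 * n + ν : ℝ) : ℂ))
    (u := fun n : ℕ => besselCoeff ν 0 * (3 / 4) ^ n)
    ((summable_geometric_of_lt_one (by norm_num) (by norm_num)).mul_left _)
    (fun n w hw => (hd n w hw).differentiableAt.differentiableWithinAt) isOpen_ball ?_
    (mem_ball_self (x := (1 : ℂ)) (by norm_num : (0 : ℝ) < 1 / 2))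
  · have ht : HasSum (fun n : ℕ => (((2 * n + ν) * besselTerm ν n : ℝ) : ℂ))
        (deriv (besselJ ν) 1) := by
      refine hs.congr_fun fun n => ?_
      rw [(hd n 1 (mem_ball_self (by norm_num))).deriv, ofReal_mul, besselTerm_cast,
        cpow_sub _ _ (by norm_num), cpow_one]
      ring
    exact ht.unique (hasSum_ofReal.2 (hasSum_deriv_besselTerm hν))
  · intro n w hw
    have hw2 : ‖w / 2‖ ≤ 3 / 4 := by
      have h := norm_le_norm_add_norm_sub' w 1
      have h' := mem_ball_iff_norm.1 hw
      rw [norm_div]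
      norm_num at h ⊢
      linarith
    rw [norm_mul, norm_real, norm_cpow_real]
    refine mul_le_mul (abs_besselCoeff_le hν n) ?_ (by positivity)
      ((abs_nonneg _).trans (abs_besselCoeff_le hν n))
    calc ‖w / 2‖ ^ (2 * n + ν : ℝ) ≤ (3 / 4 : ℝ) ^ (2 * n + ν : ℝ) := by gcongr
      _ ≤ (3 / 4 : ℝ) ^ (n : ℝ) :=
        Real.rpow_le_rpow_of_exponent_ge (by norm_num) (by norm_num)
          (by linarith [(n.cast_nonneg : (0 : ℝ) ≤ n)])
      _ = (3 / 4 : ℝ) ^ n := Real.rpow_natCast _ _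

theorem strictMonoOn_one_sub_besselOne_quotient :
    StrictMonoOn (fun ν : ℝ => 1 - besselOne (ν + 1) / (ν * besselOne ν)) (Set.Ioi 0) := by
  intro ν hν μ hμ h
  have hν' : 0 < ν := hν
  have h1 := besselOne_ratio_antitone hν h
  have h2 : 0 < besselOne (ν + 1) / besselOne ν :=
    div_pos (besselOne_pos (by positivity)) (besselOne_pos hν)
  simp only [mul_comm _ (besselOne _), ← div_div]
  exact sub_lt_sub_left ((div_le_div_of_nonneg_right h1 (le_of_lt hμ)).trans_lt
    (div_lt_div_of_pos_left h2 hν h)) 1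

/-- The function `ν ↦ 1 - J_{ν+1}(1)/(ν J_ν(1))` is strictly increasing
on `(0,∞)`; equivalently, `ν ↦ J_ν'(1)/(ν J_ν(1))` is strictly increasing on `(0,∞)`. -/
theorem strictMonoOn_bessel_quotient :
    StrictMonoOn (fun ν : ℝ => ((1 : ℂ) - besselJ (ν + 1) 1 / ((ν : ℂ) * besselJ ν 1)).re)
        (Set.Ioi (0 : ℝ)) ∧
      StrictMonoOn (fun ν : ℝ => (deriv (besselJ ν) 1 / ((ν : ℂ) * besselJ ν 1)).re)
        (Set.Ioi (0 : ℝ)) := by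
  constructor
  · refine strictMonoOn_one_sub_besselOne_quotient.congr fun ν _ => ?_
    simp only [besselJ_one]
    norm_cast
  · refine strictMonoOn_one_sub_besselOne_quotient.congr fun ν hν => ?_
    have h1 := besselOne_pos hν
    have h2 : 0 < ν := hν
    simp only [deriv_besselJ_one hν, besselJ_one]
    norm_cast
    field_simp
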